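/- Let T and Ω be independent uniformly random subsets of {1,…,n} of fixed cardinalities |T| and |Ω|, and suppose δ ∈ [1/n, 1] satisfies δ ≥ max{|T|, |Ω|}/n. Then for each integer q satisfying 13 log n ≤ q ≤ n/2, each λ ∈ [0,1], and every u ≥ 1, P( ‖F_{ΩT}‖ ≥ 8 δ^{λ} max{1, 2q n^{λ − 1/2}} · u ) ≤ 4 u^{−2q}. -/

import Mathlib

/-- The spectral norm (ℓ2 → ℓ2 operator norm) of a complex matrix. -/
noncomputable def specNorm {α β : Type*} [Fintype α] [Fintype β] [DecidableEq β]
    (A : Matrix α β ℂ) : ℝ :=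
  ‖LinearMap.toContinuousLinearMap (Matrix.toEuclideanLin A)‖

/-- The `n × n` discrete Fourier transform matrix, with entries
`F (j, t) = n^{-1/2} e^{2πi j t / n}` for `j, t = 1, …, n` (indices coded by `Fin n` via
`j ↦ j.val + 1`). -/
noncomputable def dftMatrix (n : ℕ) : Matrix (Fin n) (Fin n) ℂ := fun j t =>
  (1 / (Real.sqrt n : ℂ)) *
    Complex.exp (2 * Real.pi * Complex.I * (((j : ℕ) : ℂ) + 1) * (((t : ℕ) : ℂ) + 1) / (n : ℂ))

/-- The submatrix `F_{ΩT}` of the DFT matrix with rows indexed by `Ω` and columns by `T`. -/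
noncomputable def dftSub (n : ℕ) (Ω T : Finset (Fin n)) : Matrix Ω T ℂ :=
  (dftMatrix n).submatrix (fun ω => (ω : Fin n)) (fun t => (t : Fin n))

attribute [local instance] Classical.propDecidable

/-- The probability that a uniformly random subset `Ω ⊆ {1,…,n}` of fixed cardinality `m`
satisfies the predicate `p`: the number of subsets of cardinality `m` satisfying `p`, divided
by the total number of subsets of cardinality `m`. -/
noncomputable def uniformSetProb (n m : ℕ) (p : Finset (Fin n) → Prop) : ℝ :=
  (((Finset.powersetCard m (Finset.univ : Finset (Fin n))).filter p).card : ℝ) /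
    ((Finset.powersetCard m (Finset.univ : Finset (Fin n))).card : ℝ)

/-- The probability that a pair of independent uniformly random subsets `T, Ω ⊆ {1,…,n}` of
fixed cardinalities `mT` and `mΩ` satisfies the predicate `p`. -/
noncomputable def uniformPairProb (n mT mΩ : ℕ)
    (p : Finset (Fin n) → Finset (Fin n) → Prop) : ℝ :=
  ((((Finset.powersetCard mT (Finset.univ : Finset (Fin n))) ×ˢ
      (Finset.powersetCard mΩ (Finset.univ : Finset (Fin n)))).filter
        fun q => p q.1 q.2).card : ℝ) /
    (((Finset.powersetCard mT (Finset.univ : Finset (Fin n))).card *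
      (Finset.powersetCard mΩ (Finset.univ : Finset (Fin n))).card : ℕ) : ℝ)


open Polynomial in
theorem Polynomial.Chebyshev.eval_three_T_le (d : ℕ) :
    0 ≤ (Chebyshev.T ℝ d).eval 3 ∧ (Chebyshev.T ℝ d).eval 3 ≤ 6 ^ d := by
  have key : ∀ k : ℕ, 1 ≤ (Chebyshev.T ℝ k).eval 3 ∧
      (Chebyshev.T ℝ k).eval 3 ≤ (Chebyshev.T ℝ (k + 1)).eval 3 ∧
      (Chebyshev.T ℝ k).eval 3 ≤ 6 ^ k ∧ (Chebyshev.T ℝ (k + 1)).eval 3 ≤ 6 ^ (k + 1) := by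
    intro k
    induction k with
    | zero => norm_num
    | succ k ih =>
      obtain ⟨h1, h2, h3, h4⟩ := ih
      have h : (Chebyshev.T ℝ ((k : ℤ) + 1 + 1)).eval 3 =
          6 * (Chebyshev.T ℝ (k + 1)).eval 3 - (Chebyshev.T ℝ k).eval 3 := by
        rw [show (k : ℤ) + 1 + 1 = k + 2 by ring, Chebyshev.T_add_two]
        simp
        norm_num
      push_cast
      rw [h, pow_succ _ (k + 1)]
      refine ⟨by linarith, by linarith, h4, by linarith⟩
  exact ⟨by linarith [(key d).1], (key d).2.2.1⟩

open Polynomial in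
/-- A polynomial of degree at most `d` bounded by `M` on `[0, 1]` has coefficients bounded by
`6 ^ d * M`. -/
theorem Polynomial.abs_coeff_le_of_forall_abs_le {d : ℕ} {p : ℝ[X]} {M : ℝ}
    (hp : p.degree ≤ d) (hM : ∀ x ∈ Set.Icc (0 : ℝ) 1, |p.eval x| ≤ M) (k : ℕ) :
    |p.coeff k| ≤ 6 ^ d * M := by
  have hT : ∀ k, 0 ≤ (derivative^[k] (Chebyshev.T ℝ d)).eval 1 := fun k => by
    simpa using Chebyshev.eval_iterate_derivative_le_of_forall_abs_le_one (P := 0) (n := d)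
      (k := k) le_rfl (by simp) (by simp)
  have hasse : ∀ (P : ℝ[X]) k, (k.factorial : ℝ) * (taylor 1 P).coeff k =
      (derivative^[k] P).eval 1 := fun P k => by
    rw [taylor_coeff, ← factorial_smul_hasseDeriv]
    simp [nsmul_eq_mul]
  have key : ∀ P : ℝ[X], P.degree ≤ d → (∀ x ∈ Set.Icc (-1 : ℝ) 1, |P.eval x| ≤ 1) →
      ∀ k, (taylor 1 P).coeff k * 2 ^ k ≤ 6 ^ d := by
    intro P hP hb k
    have h1 := Chebyshev.eval_iterate_derivative_le_of_forall_abs_le_one (k := k) le_rfl hP hb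
    rw [← hasse, ← hasse] at h1
    have h2 : (taylor 1 P).coeff k ≤ (taylor 1 (Chebyshev.T ℝ d)).coeff k :=
      le_of_mul_le_mul_left h1 (by positivity)
    have h0 : ∀ k, 0 ≤ (taylor 1 (Chebyshev.T ℝ d)).coeff k := fun k => by
      have := hT k
      rw [← hasse] at this
      exact nonneg_of_mul_nonneg_right this (by positivity)
    have h3 : (Chebyshev.T ℝ d).eval 3 =
        ∑ i ∈ Finset.range (max (d + 1) (k + 1)), (taylor 1 (Chebyshev.T ℝ d)).coeff i * 2 ^ i := by
      rw [show (3 : ℝ) = 2 + 1 by norm_num, ← taylor_eval]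
      refine eval_eq_sum_range' ?_ _
      rw [natDegree_taylor, Chebyshev.natDegree_T]
      simp
    calc (taylor 1 P).coeff k * 2 ^ k ≤ (taylor 1 (Chebyshev.T ℝ d)).coeff k * 2 ^ k := by gcongr
      _ ≤ ∑ i ∈ Finset.range (max (d + 1) (k + 1)),
          (taylor 1 (Chebyshev.T ℝ d)).coeff i * 2 ^ i :=
        Finset.single_le_sum (f := fun i => (taylor 1 (Chebyshev.T ℝ d)).coeff i * 2 ^ i)
          (fun i _ => mul_nonneg (h0 i) (by positivity)) (by simp)
      _ ≤ 6 ^ d := h3 ▸ (Chebyshev.eval_three_T_le d).2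
  have hM0 : 0 ≤ M := (abs_nonneg _).trans (hM 0 (by simp))
  have main : ∀ N : ℝ, M ≤ N → 0 < N → |p.coeff k| ≤ 6 ^ d * N := by
    intro N hN hN0
    have scaled : ∀ c : ℝ, |c| = 1 / N → p.coeff k * ((-1) ^ k * c) ≤ 6 ^ d := by
      intro c hc
      have h := key (C c * p.comp (C (-1 / 2) * X + C (1 / 2))) ?_ ?_ k
      · rw [taylor_apply, mul_comp, comp_assoc] at h
        have e : (C (-1 / 2 : ℝ) * X + C (1 / 2)).comp (X + C 1) = C (-1 / 2) * X := by
          simp only [add_comp, mul_comp, C_comp, X_comp, mul_add, ← C_mul, add_assoc, ← C_add]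
          norm_num
        rw [e, C_comp, coeff_C_mul, comp_C_mul_X_coeff] at h
        convert h using 1
        have : ((-1 / 2 : ℝ)) ^ k * 2 ^ k = (-1) ^ k := by rw [← mul_pow]; norm_num
        linear_combination (-(p.coeff k * c)) * this
      · refine degree_le_of_natDegree_le ?_
        refine (natDegree_C_mul_le _ _).trans ?_
        refine natDegree_comp_le.trans ?_
        have h1 : (C (-1 / 2 : ℝ) * X + C (1 / 2)).natDegree ≤ 1 := natDegree_linear_le
        have h2 : p.natDegree ≤ d := natDegree_le_of_degree_le hp
        calc _ ≤ d * 1 := Nat.mul_le_mul h2 h1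
          _ = d := mul_one d
      · intro x hx
        simp only [eval_mul, eval_C, eval_comp, eval_add, eval_X, abs_mul, hc]
        rw [one_div, inv_mul_le_iff₀ hN0, mul_one]
        exact (hM _ ⟨by linarith [hx.2], by linarith [hx.1]⟩).trans hN
    have h1 := scaled (1 / N) (by rw [abs_of_pos (by positivity)])
    have h2 := scaled (-(1 / N)) (by rw [abs_neg, abs_of_pos (by positivity)])
    have h3 : |p.coeff k * (1 / N)| ≤ 6 ^ d := by
      rcases neg_one_pow_eq_or ℝ k with h | h <;> rw [h] at h1 h2 <;> rw [abs_le] <;>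
        constructor <;> linarith
    rw [abs_mul, abs_of_pos (by positivity : 0 < 1 / N), mul_one_div, div_le_iff₀ hN0] at h3
    exact h3
  rcases hM0.eq_or_lt with h | h
  · refine le_of_forall_pos_le_add fun ε hε => ?_
    have := main (ε / 6 ^ d) (by rw [← h]; positivity) (by positivity)
    rw [← h, mul_zero, zero_add]
    rwa [mul_div_cancel₀ _ (by positivity)] at this
  · exact main M le_rfl h

section
open scoped Matrix.Norms.L2Operator Matrix

namespace Matrix
variable {ι : Type*} [Fintype ι] [DecidableEq ι]

theorem l2_opNorm_sq_le_sum_norm_sq (B : Matrix ι ι ℂ) : ‖B‖ ^ 2 ≤ ∑ i, ∑ j, ‖B i j‖ ^ 2 := by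
  have h0 : 0 ≤ ∑ i, ∑ j, ‖B i j‖ ^ 2 := by positivity
  rw [← Real.le_sqrt (norm_nonneg _) h0, cstar_norm_def]
  refine ContinuousLinearMap.opNorm_le_bound _ (Real.sqrt_nonneg _) fun x => ?_
  rw [EuclideanSpace.norm_eq, EuclideanSpace.norm_eq, ← Real.sqrt_mul h0]
  refine Real.sqrt_le_sqrt ?_
  rw [Finset.sum_mul]
  refine Finset.sum_le_sum fun i _ => ?_
  have : (toEuclideanCLM (n := ι) (𝕜 := ℂ) B x) i = ∑ j, B i j * x j := by
    simp [ofLp_toEuclideanCLM, mulVec, dotProduct]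
  rw [this]
  calc ‖∑ j, B i j * x j‖ ^ 2 ≤ (∑ j, ‖B i j‖ * ‖x j‖) ^ 2 := by
        gcongr
        refine (norm_sum_le _ _).trans (Finset.sum_le_sum fun j _ => ?_)
        rw [norm_mul]
    _ ≤ _ := Finset.sum_mul_sq_le_sq_mul_sq _ _ _

theorem norm_entry_le_l2_opNorm (B : Matrix ι ι ℂ) (i j : ι) : ‖B i j‖ ≤ ‖B‖ := by
  have h := l2_opNorm_mulVec B (EuclideanSpace.single j 1)
  rw [PiLp.norm_single, norm_one, mul_one] at h
  refine le_trans ?_ h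
  refine le_trans ?_ (PiLp.norm_apply_le _ i)
  simp

theorem re_trace_mul_conjTranspose {ι : Type*} [Fintype ι] (C : Matrix ι ι ℂ) :
    (C * Cᴴ).trace.re = ∑ i, ∑ j, ‖C i j‖ ^ 2 := by
  simp only [trace, diag, mul_apply, conjTranspose_apply, Complex.re_sum]
  refine Finset.sum_congr rfl fun i _ => Finset.sum_congr rfl fun j _ => ?_
  rw [Complex.star_def, Complex.mul_conj, Complex.ofReal_re, Complex.normSq_eq_norm_sq]

theorem norm_pow_le_re_trace (B : Matrix ι ι ℂ) {q : ℕ} (hq : q ≠ 0) :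
    ‖B‖ ^ (2 * q) ≤ ((B * Bᴴ) ^ q).trace.re := by
  have hsa : (B * Bᴴ)ᴴ = B * Bᴴ := by simp
  have hn : ‖B * Bᴴ‖ = ‖B‖ ^ 2 := by
    rw [sq]; exact CStarRing.norm_self_mul_star
  have h1 : ‖B * Bᴴ‖ ^ q ≤ ‖(B * Bᴴ) ^ q‖ := by
    rcases (norm_nonneg (B * Bᴴ)).eq_or_lt with h | h
    · rw [← h, zero_pow hq]; exact norm_nonneg _
    · have hle : q ≤ 2 ^ q := Nat.lt_two_pow_self.le
      have h2 := IsSelfAdjoint.norm_pow_two_pow (x := B * Bᴴ) hsa q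
      have h3 : ‖B * Bᴴ‖ ^ (2 ^ q) ≤ ‖(B * Bᴴ) ^ q‖ * ‖B * Bᴴ‖ ^ (2 ^ q - q) := by
        rcases hle.eq_or_lt with he | hlt
        · rw [← h2, ← he, Nat.sub_self, pow_zero, mul_one]
        · rw [← h2]
          conv_lhs => rw [← Nat.add_sub_of_le hle, pow_add]
          exact (norm_mul_le _ _).trans
            (mul_le_mul_of_nonneg_left (norm_pow_le' _ (by omega)) (norm_nonneg _))
      rw [← Nat.add_sub_of_le hle, pow_add, Nat.add_sub_of_le hle] at h3
      exact le_of_mul_le_mul_right h3 (by positivity)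
  obtain ⟨C, hC⟩ : ∃ C : Matrix ι ι ℂ, (B * Bᴴ) ^ q = C * Cᴴ := by
    obtain ⟨k, rfl | rfl⟩ := q.even_or_odd'
    · exact ⟨(B * Bᴴ) ^ k, by rw [conjTranspose_pow, hsa, ← pow_add, two_mul]⟩
    · refine ⟨(B * Bᴴ) ^ k * B, ?_⟩
      rw [conjTranspose_mul, conjTranspose_pow, hsa, Matrix.mul_assoc, ← Matrix.mul_assoc B,
        ← pow_succ', ← pow_add]
      congr 1
      ring
  rw [pow_mul, ← hn]
  refine h1.trans ?_
  rw [hC, re_trace_mul_conjTranspose]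
  refine le_trans (le_of_eq ?_) (l2_opNorm_sq_le_sum_norm_sq C)
  rw [sq]; exact CStarRing.norm_self_mul_star

theorem re_trace_le_card_mul_norm (P : Matrix ι ι ℂ) :
    P.trace.re ≤ Fintype.card ι * ‖P‖ := by
  rw [trace, Complex.re_sum, ← nsmul_eq_mul, ← Finset.card_univ]
  exact Finset.sum_le_card_nsmul _ _ _ fun i _ =>
    (Complex.re_le_norm _).trans (norm_entry_le_l2_opNorm P i i)

theorem re_trace_pow_le (B : Matrix ι ι ℂ) {q : ℕ} (hq : q ≠ 0) :
    ((B * Bᴴ) ^ q).trace.re ≤ Fintype.card ι * ‖B‖ ^ (2 * q) := by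
  refine (re_trace_le_card_mul_norm _).trans ?_
  gcongr
  rw [pow_mul, sq, ← CStarRing.norm_self_mul_star]
  exact norm_pow_le' _ (Nat.pos_of_ne_zero hq)

/-- Cyclicity of the trace absorbs an idempotent factor. -/
theorem trace_idempotent_mul_mul_pow {D : Matrix ι ι ℂ} (hD : D * D = D)
    (G : Matrix ι ι ℂ) {q : ℕ} (hq : q ≠ 0) :
    ((D * G * D) ^ q).trace = ((D * G) ^ q).trace := by
  have h : ∀ k, (D * G * D) ^ (k + 1) = (D * G) ^ (k + 1) * D := by
    intro k
    induction k with
    | zero => simp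
    | succ k ih =>
      rw [pow_succ, ih, pow_succ _ (k + 1)]
      simp only [← Matrix.mul_assoc]
      rw [Matrix.mul_assoc _ D D, hD]
  obtain ⟨k, rfl⟩ := Nat.exists_eq_succ_of_ne_zero hq
  rw [Nat.succ_eq_add_one, h, trace_mul_comm, pow_succ', ← Matrix.mul_assoc, ← Matrix.mul_assoc, hD]

end Matrix

open Finset

section Bernoulli
variable {ι : Type*} [Fintype ι] [DecidableEq ι]

/-- The probability of `T` when each index is selected independently with probability `s`. -/
noncomputable def bernoulliWeight (s : ℝ) (T : Finset ι) : ℝ := s ^ #T * (1 - s) ^ #Tᶜ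

theorem bernoulliWeight_nonneg {s : ℝ} (h0 : 0 ≤ s) (h1 : s ≤ 1) (T : Finset ι) :
    0 ≤ bernoulliWeight s T :=
  mul_nonneg (pow_nonneg h0 _) (pow_nonneg (sub_nonneg.mpr h1) _)

theorem sum_bernoulliWeight_mul_subset (s : ℝ) (S : Finset ι) :
    ∑ T, bernoulliWeight s T * (if S ⊆ T then 1 else 0) = s ^ #S := by
  have h := prod_add (fun _ => s) (fun i => if i ∈ S then 0 else 1 - s) (univ : Finset ι)
  rw [powerset_univ] at h
  have e : ∏ i : ι, (s + if i ∈ S then 0 else 1 - s) = s ^ #S := by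
    rw [← prod_filter_mul_prod_filter_not univ (· ∈ S)]
    rw [prod_congr rfl (g := fun _ => s) (by intro x hx; simp [(mem_filter.mp hx).2]),
      prod_congr (s₁ := univ.filter (· ∉ S)) rfl (g := fun _ => 1)
        (by intro x hx; simp [(mem_filter.mp hx).2])]
    simp
  rw [← e, h]
  refine sum_congr rfl fun T _ => ?_
  rw [prod_const, bernoulliWeight, mul_assoc, ← compl_eq_univ_sdiff]
  congr 1
  split_ifs with hST
  · rw [prod_congr rfl (g := fun _ => 1 - s)]
    · simp
    · intro x hx
      rw [if_neg fun hxS => (mem_compl.mp hx) (hST hxS)]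
  · obtain ⟨x, hxS, hxT⟩ := not_subset.mp hST
    rw [prod_eq_zero (i := x) (mem_compl.mpr hxT) (by simp [hxS]), mul_zero]

theorem sum_bernoulliWeight (s : ℝ) : ∑ T : Finset ι, bernoulliWeight s T = 1 := by
  simpa using sum_bernoulliWeight_mul_subset s (∅ : Finset ι)

theorem sum_bernoulliWeight_mul_exp_card (s : ℝ) :
    ∑ T : Finset ι, bernoulliWeight s T * Real.exp #T =
      (1 + s * (Real.exp 1 - 1)) ^ Fintype.card ι := by
  have h := prod_add (fun _ => s * Real.exp 1) (fun _ => 1 - s) (univ : Finset ι)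
  rw [powerset_univ, prod_const, card_univ] at h
  rw [show 1 + s * (Real.exp 1 - 1) = s * Real.exp 1 + (1 - s) by ring, h]
  refine sum_congr rfl fun T _ => ?_
  rw [prod_const, prod_const, bernoulliWeight, ← compl_eq_univ_sdiff, mul_pow, ← Real.exp_nat_mul,
    mul_one]
  ring

/-- Moments of a binomial variable of mean at most one. -/
theorem sum_bernoulliWeight_mul_card_pow_le {s : ℝ} (h0 : 0 ≤ s) (h1 : s ≤ 1)
    (hs : s * Fintype.card ι ≤ 1) {q : ℕ} (hq : 2 ≤ q) :
    ∑ T : Finset ι, bernoulliWeight s T * (#T : ℝ) ^ q ≤ (q : ℝ) ^ q := by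
  have hq0 : (0 : ℝ) < q := by positivity
  have hpt : ∀ T : Finset ι, (#T : ℝ) ^ q ≤ (q : ℝ) ^ q * Real.exp (-q) * Real.exp #T := by
    intro T
    have h := Real.add_one_le_exp ((#T : ℝ) / q - 1)
    rw [sub_add_cancel] at h
    have h2 := pow_le_pow_left₀ (by positivity) h q
    rw [← Real.exp_nat_mul, div_pow, div_le_iff₀ (by positivity)] at h2
    rw [mul_assoc, ← Real.exp_add]
    refine h2.trans (le_of_eq ?_)
    rw [mul_comm]
    congr 2
    field_simp
    ring
  calc ∑ T : Finset ι, bernoulliWeight s T * (#T : ℝ) ^ q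
      ≤ ∑ T : Finset ι, bernoulliWeight s T * ((q : ℝ) ^ q * Real.exp (-q) * Real.exp #T) :=
        sum_le_sum fun T _ => mul_le_mul_of_nonneg_left (hpt T) (bernoulliWeight_nonneg h0 h1 T)
    _ = (q : ℝ) ^ q * Real.exp (-q) * ∑ T : Finset ι, bernoulliWeight s T * Real.exp #T := by
        rw [mul_sum]; exact sum_congr rfl fun T _ => by ring
    _ ≤ (q : ℝ) ^ q * Real.exp (-q) * Real.exp q := by
        gcongr
        rw [sum_bernoulliWeight_mul_exp_card]
        have he : (0 : ℝ) ≤ Real.exp 1 - 1 := by linarith [Real.add_one_le_exp (1 : ℝ)]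
        calc (1 + s * (Real.exp 1 - 1)) ^ Fintype.card ι
            ≤ (Real.exp (s * (Real.exp 1 - 1))) ^ Fintype.card ι := by
              gcongr
              rw [add_comm]; exact Real.add_one_le_exp _
          _ = Real.exp (s * Fintype.card ι * (Real.exp 1 - 1)) := by
              rw [← Real.exp_nat_mul]; ring_nf
          _ ≤ Real.exp q := by
              apply Real.exp_le_exp.mpr
              have : (2 : ℝ) ≤ q := by exact_mod_cast hq
              nlinarith [Real.exp_one_lt_d9]
    _ = (q : ℝ) ^ q := by rw [mul_assoc, ← Real.exp_add]; simp

/-- The binomial distribution with mean `m` has its mode at `m`. -/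
theorem Nat.choose_mul_pow_mul_pow_le {n m k : ℕ} (hm : m ≤ n) (hk : k ≤ n) :
    n.choose k * m ^ k * (n - m) ^ (n - k) ≤ n.choose m * m ^ m * (n - m) ^ (n - m) := by
  set f : ℕ → ℕ := fun k => n.choose k * m ^ k * (n - m) ^ (n - k) with hf
  have hchoose : ∀ k, n.choose (k + 1) * (k + 1) = n.choose k * (n - k) := Nat.choose_succ_right_eq n
  have hrel : ∀ k, k < n → f (k + 1) * ((k + 1) * (n - m)) = f k * ((n - k) * m) := by
    intro k hk
    simp only [hf]
    have h1 : n - k = n - (k + 1) + 1 := by omega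
    calc n.choose (k + 1) * m ^ (k + 1) * (n - m) ^ (n - (k + 1)) * ((k + 1) * (n - m))
        = (n.choose (k + 1) * (k + 1)) * m ^ (k + 1) * (n - m) ^ (n - (k + 1) + 1) := by ring
      _ = n.choose k * (n - k) * m ^ (k + 1) * (n - m) ^ (n - k) := by rw [hchoose, ← h1]
      _ = _ := by ring
  have hup : ∀ k, k < m → f k ≤ f (k + 1) := by
    intro k hkm
    have hpos : 0 < (n - k) * m := Nat.mul_pos (by omega) (by omega)
    refine le_of_mul_le_mul_right ?_ hpos
    rw [← hrel k (by omega)]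
    refine Nat.mul_le_mul_left _ ?_
    zify [hm, (by omega : k ≤ n)]
    have : (k : ℤ) + 1 ≤ m := by exact_mod_cast hkm
    have : (m : ℤ) ≤ n := by exact_mod_cast hm
    nlinarith
  have hdown : ∀ k, m ≤ k → k < n → f (k + 1) ≤ f k := by
    intro k hmk hkn
    have hpos : 0 < (k + 1) * (n - m) := Nat.mul_pos (by omega) (by omega)
    refine le_of_mul_le_mul_right ?_ hpos
    rw [hrel k hkn]
    refine Nat.mul_le_mul_left _ ?_
    zify [hm, hkn.le]
    have : (m : ℤ) ≤ k := by exact_mod_cast hmk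
    have : (k : ℤ) + 1 ≤ n := by exact_mod_cast hkn
    nlinarith
  rcases le_total k m with h | h
  · have : ∀ j, k + j ≤ m → f k ≤ f (k + j) := by
      intro j
      induction j with
      | zero => simp
      | succ j ih => exact fun hj => (ih (by omega)).trans (hup (k + j) (by omega))
    simpa [Nat.add_sub_of_le h] using this (m - k) (by omega)
  · have : ∀ j, m + j ≤ n → f (m + j) ≤ f m := by
      intro j
      induction j with
      | zero => simp
      | succ j ih => exact fun hj => (hdown (m + j) (by omega) (by omega)).trans (ih (by omega))
    simpa [Nat.add_sub_of_le h] using this (k - m) (by omega)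

theorem one_le_succ_mul_choose_mul_pow {n m : ℕ} (hn : n ≠ 0) (hm : m ≤ n) :
    1 ≤ ((n : ℝ) + 1) *
      (n.choose m * (((m : ℝ) / n) ^ m * (1 - (m : ℝ) / n) ^ (n - m))) := by
  have hn0 : (n : ℝ) ≠ 0 := by exact_mod_cast hn
  have h : n ^ n ≤ (n + 1) * (n.choose m * m ^ m * (n - m) ^ (n - m)) := by
    calc n ^ n = (m + (n - m)) ^ n := by rw [Nat.add_sub_of_le hm]
      _ = ∑ k ∈ range (n + 1), n.choose k * m ^ k * (n - m) ^ (n - k) := by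
          rw [add_pow]; exact sum_congr rfl fun k _ => by rw [Nat.cast_id]; ring
      _ ≤ ∑ k ∈ range (n + 1), n.choose m * m ^ m * (n - m) ^ (n - m) :=
          sum_le_sum fun k hk =>
            Nat.choose_mul_pow_mul_pow_le hm (Nat.lt_succ_iff.mp (mem_range.mp hk))
      _ = _ := by simp
  have h' : (n : ℝ) ^ n ≤ (n + 1) * (n.choose m * m ^ m * (n - m) ^ (n - m)) := by
    have := (Nat.cast_le (α := ℝ)).mpr h
    push_cast [hm] at this
    exact this
  have e : (1 - (m : ℝ) / n) = (n - m) / n := by field_simp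
  rw [e, div_pow, div_pow, div_mul_div_comm, ← pow_add, Nat.add_sub_of_le hm, mul_div_assoc',
    mul_div_assoc', le_div_iff₀ (by positivity), one_mul]
  linarith

/-- Averages over sets of fixed size are controlled by averages over Bernoulli sets. -/
theorem sum_powersetCard_le_sum_bernoulliWeight {m : ℕ} (hn : Fintype.card ι ≠ 0)
    (hm : m ≤ Fintype.card ι) {g : Finset ι → ℝ} (hg : ∀ T, 0 ≤ g T) :
    ∑ T ∈ powersetCard m univ, g T ≤ ((Fintype.card ι : ℝ) + 1) * (Fintype.card ι).choose m *
      ∑ T, bernoulliWeight ((m : ℝ) / Fintype.card ι) T * g T := by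
  set n := Fintype.card ι with hn'
  have hs0 : (0 : ℝ) ≤ (m : ℝ) / n := by positivity
  have hs1 : (m : ℝ) / n ≤ 1 := div_le_one_of_le₀ (by exact_mod_cast hm) (by positivity)
  calc ∑ T ∈ powersetCard m univ, g T
      ≤ ∑ T ∈ powersetCard m univ, ((n : ℝ) + 1) * n.choose m *
          (bernoulliWeight ((m : ℝ) / n) T * g T) := by
        refine sum_le_sum fun T hT => ?_
        have hc : #T = m := (mem_powersetCard.mp hT).2
        have := one_le_succ_mul_choose_mul_pow hn hm
        rw [bernoulliWeight, card_compl, hc, ← hn']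
        nlinarith [hg T]
    _ = ((n : ℝ) + 1) * n.choose m *
          ∑ T ∈ powersetCard m univ, bernoulliWeight ((m : ℝ) / n) T * g T := by rw [mul_sum]
    _ ≤ _ := by
        gcongr
        · exact fun T _ _ => mul_nonneg (bernoulliWeight_nonneg hs0 hs1 T) (hg T)
        · exact subset_univ _

end Bernoulli

section IndicatorDegree
variable {ι : Type*} [DecidableEq ι]

/-- Functions of a pair of sets that are polynomials of degree at most `a` in the indicators of the
first set and at most `b` in the indicators of the second one. -/
def indicatorDegree (ι : Type*) [DecidableEq ι] (a b : ℕ) :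
    Submodule ℂ (Finset ι × Finset ι → ℂ) :=
  Submodule.span ℂ {f | ∃ S S' : Finset ι, #S ≤ a ∧ #S' ≤ b ∧
    f = fun p => if S ⊆ p.1 ∧ S' ⊆ p.2 then 1 else 0}

theorem mul_mem_indicatorDegree {a b a' b' : ℕ} {f g : Finset ι × Finset ι → ℂ}
    (hf : f ∈ indicatorDegree ι a b) (hg : g ∈ indicatorDegree ι a' b') :
    f * g ∈ indicatorDegree ι (a + a') (b + b') := by
  have h := Submodule.mul_mem_mul hf hg
  rw [indicatorDegree, indicatorDegree, Submodule.span_mul_span] at h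
  refine Submodule.span_mono ?_ h
  rintro _ ⟨_, ⟨S, S', hS, hS', rfl⟩, _, ⟨R, R', hR, hR', rfl⟩, rfl⟩
  refine ⟨S ∪ R, S' ∪ R', (card_union_le _ _).trans (by omega),
    (card_union_le _ _).trans (by omega), ?_⟩
  funext p
  simp only [Pi.mul_apply, union_subset_iff, ← ite_and, mul_ite, mul_one, mul_zero]
  congr 1
  grind

theorem indicator_mem_indicatorDegree (i j : ι) :
    (fun p : Finset ι × Finset ι => if i ∈ p.1 ∧ j ∈ p.2 then (1 : ℂ) else 0) ∈
      indicatorDegree ι 1 1 :=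
  Submodule.subset_span ⟨{i}, {j}, by simp, by simp, by simp⟩

theorem trace_pow_mem_indicatorDegree [Fintype ι] {N : Finset ι × Finset ι → Matrix ι ι ℂ}
    (hN : ∀ i j, (fun p => N p i j) ∈ indicatorDegree ι 1 1) (k : ℕ) :
    (fun p => (N p ^ k).trace) ∈ indicatorDegree ι k k := by
  have h : ∀ k i j, (fun p => (N p ^ k) i j) ∈ indicatorDegree ι k k := by
    intro k
    induction k with
    | zero =>
      intro i j
      have e : (fun p => (N p ^ 0) i j) =
          (1 : Matrix ι ι ℂ) i j • fun p : Finset ι × Finset ι =>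
            if (∅ : Finset ι) ⊆ p.1 ∧ (∅ : Finset ι) ⊆ p.2 then (1 : ℂ) else 0 := by
        funext p; simp
      rw [e]
      exact Submodule.smul_mem _ _ (Submodule.subset_span ⟨∅, ∅, by simp, by simp, rfl⟩)
    | succ k ih =>
      intro i j
      have e : (fun p => (N p ^ (k + 1)) i j) =
          ∑ l, (fun p => (N p ^ k) i l) * fun p => N p l j := by
        funext p; simp [pow_succ, Matrix.mul_apply]
      rw [e]
      exact Submodule.sum_mem _ fun l _ => mul_mem_indicatorDegree (ih i l) (hN l j)
  have e : (fun p => (N p ^ k).trace) = ∑ i, fun p => (N p ^ k) i i := by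
    funext p; simp [Matrix.trace]
  rw [e]
  exact Submodule.sum_mem _ fun i _ => h k i i

/-- Bernoulli expectations of functions of bounded indicator degree are polynomials. -/
theorem exists_coeff_of_mem_indicatorDegree [Fintype ι] {a b : ℕ} {f : Finset ι × Finset ι → ℂ}
    (hf : f ∈ indicatorDegree ι a b) :
    ∃ c : ℕ → ℕ → ℝ, ∀ s t : ℝ,
      ∑ T, bernoulliWeight s T * ∑ W, bernoulliWeight t W * (f (T, W)).re =
        ∑ i ∈ range (a + 1), (∑ j ∈ range (b + 1), c i j * t ^ j) * s ^ i := by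
  suffices h : ∃ c : ℕ → ℕ → ℂ, ∀ s t : ℝ,
      ∑ T, (bernoulliWeight s T : ℂ) * ∑ W, (bernoulliWeight t W : ℂ) * f (T, W) =
        ∑ i ∈ range (a + 1), (∑ j ∈ range (b + 1), c i j * (t : ℂ) ^ j) * (s : ℂ) ^ i by
    obtain ⟨c, hc⟩ := h
    refine ⟨fun i j => (c i j).re, fun s t => ?_⟩
    have := congrArg Complex.re (hc s t)
    simpa only [Complex.re_sum, Complex.re_ofReal_mul, ← Complex.ofReal_pow,
      Complex.re_mul_ofReal] using this
  induction hf using Submodule.span_induction with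
  | mem f h =>
    obtain ⟨S, S', hS, hS', rfl⟩ := h
    refine ⟨fun i j => if i = #S ∧ j = #S' then 1 else 0, fun s t => ?_⟩
    have h1 : ∑ i ∈ range (a + 1), (∑ j ∈ range (b + 1),
        (if i = #S ∧ j = #S' then (1 : ℂ) else 0) * (t : ℂ) ^ j) * (s : ℂ) ^ i =
        (t : ℂ) ^ #S' * (s : ℂ) ^ #S := by
      rw [sum_eq_single (#S), sum_eq_single (#S')]
      · simp
      · intro j _ hj; simp [hj]
      · intro h; exact absurd (mem_range.mpr (by omega)) h
      · intro i _ hi; simp [hi]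
      · intro h; exact absurd (mem_range.mpr (by omega)) h
    rw [h1]
    have h2 := congrArg (fun x : ℝ => (x : ℂ)) (sum_bernoulliWeight_mul_subset s S)
    have h3 := congrArg (fun x : ℝ => (x : ℂ)) (sum_bernoulliWeight_mul_subset t S')
    simp only [Complex.ofReal_sum, Complex.ofReal_mul, Complex.ofReal_pow] at h2 h3
    rw [← h2, ← h3, mul_comm, sum_mul]
    refine sum_congr rfl fun T _ => ?_
    rw [mul_assoc, mul_sum, mul_sum, mul_sum]
    refine sum_congr rfl fun W _ => ?_
    split_ifs <;> simp_all
  | zero => exact ⟨0, fun s t => by simp⟩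
  | add f g _ _ hf hg =>
    obtain ⟨c, hc⟩ := hf
    obtain ⟨d, hd⟩ := hg
    refine ⟨c + d, fun s t => ?_⟩
    simp only [Pi.add_apply, mul_add, add_mul, sum_add_distrib, hc, hd]
  | smul z f _ hf =>
    obtain ⟨c, hc⟩ := hf
    refine ⟨z • c, fun s t => ?_⟩
    have := congrArg (z * ·) (hc s t)
    simp only [mul_sum, sum_mul, Pi.smul_apply, smul_eq_mul] at this ⊢
    convert this using 1
    · exact sum_congr rfl fun _ _ => sum_congr rfl fun _ _ => by ring
    · exact sum_congr rfl fun _ _ => sum_congr rfl fun _ _ => by ring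

end IndicatorDegree

section Extrapolation

/-- Coefficient bounds for bivariate polynomials bounded on the square `[0, r] ^ 2`. -/
theorem abs_coeff_mul_pow_le_of_forall_abs_le {d : ℕ} {c : ℕ → ℕ → ℝ} {M r : ℝ} (hr : 0 ≤ r)
    (hM : ∀ s ∈ Set.Icc 0 r, ∀ t ∈ Set.Icc 0 r,
      |∑ i ∈ range (d + 1), (∑ j ∈ range (d + 1), c i j * t ^ j) * s ^ i| ≤ M)
    {i j : ℕ} (hi : i ≤ d) (hj : j ≤ d) :
    |c i j| * r ^ (i + j) ≤ 36 ^ d * M := by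
  have one_var : ∀ (a : ℕ → ℝ) (K : ℝ),
      (∀ s ∈ Set.Icc 0 r, |∑ i ∈ range (d + 1), a i * s ^ i| ≤ K) →
      ∀ i ≤ d, |a i * r ^ i| ≤ 6 ^ d * K := by
    intro a K ha i hi
    have h := Polynomial.abs_coeff_le_of_forall_abs_le (d := d) (M := K)
      (p := ∑ i ∈ range (d + 1), Polynomial.monomial i (a i * r ^ i)) ?_ ?_ i
    · rw [Polynomial.finsetSum_coeff, sum_eq_single i] at h
      · simpa using h
      · intro k _ hk; rw [Polynomial.coeff_monomial, if_neg hk]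
      · intro hn; exact absurd (mem_range.mpr (by omega)) hn
    · refine (Polynomial.degree_sum_le _ _).trans (Finset.sup_le fun k hk => ?_)
      refine (Polynomial.degree_monomial_le _ _).trans ?_
      exact_mod_cast Nat.lt_succ_iff.mp (mem_range.mp hk)
    · intro x hx
      have := ha (r * x) ⟨mul_nonneg hr hx.1, mul_le_of_le_one_right hr hx.2⟩
      rw [Polynomial.eval_finsetSum]
      simpa [mul_pow, mul_assoc] using this
  have h1 : ∀ t ∈ Set.Icc 0 r,
      |∑ j ∈ range (d + 1), c i j * r ^ i * t ^ j| ≤ 6 ^ d * M := by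
    intro t ht
    have := one_var (fun i => ∑ j ∈ range (d + 1), c i j * t ^ j) M
      (fun s hs => hM s hs t ht) i hi
    rw [sum_mul] at this
    convert this using 3
    ring
  have h2 := one_var (fun j => c i j * r ^ i) (6 ^ d * M) h1 j hj
  rw [mul_assoc, ← pow_add, abs_mul, abs_of_nonneg (pow_nonneg hr _), ← mul_assoc,
    ← mul_pow] at h2
  norm_num at h2
  exact h2

/-- Extrapolation of a bivariate polynomial from bounds on `[0, 1] ^ 2` and `[0, 1 / n] ^ 2`. -/
theorem polynomial_extrapolation {q n : ℕ} (hn : n ≠ 0) {c : ℕ → ℕ → ℝ}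
    (h1 : ∀ s ∈ Set.Icc (0 : ℝ) 1, ∀ t ∈ Set.Icc (0 : ℝ) 1,
      |∑ i ∈ range (q + 1), (∑ j ∈ range (q + 1), c i j * t ^ j) * s ^ i| ≤ n)
    (h2 : ∀ s ∈ Set.Icc (0 : ℝ) (1 / n), ∀ t ∈ Set.Icc (0 : ℝ) (1 / n),
      |∑ i ∈ range (q + 1), (∑ j ∈ range (q + 1), c i j * t ^ j) * s ^ i| ≤
        n * ((q : ℝ) ^ (2 * q) / n ^ q))
    {δ : ℝ} (hδ0 : 1 / (n : ℝ) ≤ δ) (hδ1 : δ ≤ 1) {lam : ℝ}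
    {s t : ℝ} (hs : s ∈ Set.Icc 0 δ) (ht : t ∈ Set.Icc 0 δ) :
    ∑ i ∈ range (q + 1), (∑ j ∈ range (q + 1), c i j * t ^ j) * s ^ i ≤
      ((q : ℝ) + 1) ^ 2 * (36 ^ q * n *
        (δ ^ lam * max 1 (2 * q * (n : ℝ) ^ (lam - 1 / 2))) ^ (2 * q)) := by
  set m := max 1 (2 * q * (n : ℝ) ^ (lam - 1 / 2)) with hm
  have hn0 : (0 : ℝ) < n := by exact_mod_cast Nat.pos_of_ne_zero hn
  have hδ : 0 < δ := lt_of_lt_of_le (by positivity) hδ0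
  have hδn : 1 ≤ δ * n := by rwa [div_le_iff₀ hn0] at hδ0
  have hm1 : 1 ≤ m := le_max_left _ _
  have coeff : ∀ i ≤ q, ∀ j ≤ q, |c i j| * δ ^ (i + j) ≤ 36 ^ q * n * (δ ^ lam * m) ^ (2 * q) := by
    intro i hi j hj
    rcases le_total (lam * (2 * q)) ((i + j : ℕ) : ℝ) with h | h
    · have hc := abs_coeff_mul_pow_le_of_forall_abs_le zero_le_one h1 hi hj
      rw [one_pow, mul_one] at hc
      refine mul_le_mul hc ?_ (by positivity) (by positivity)
      calc δ ^ (i + j) = δ ^ ((i + j : ℕ) : ℝ) := (Real.rpow_natCast _ _).symm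
        _ ≤ δ ^ (lam * (2 * q)) := Real.rpow_le_rpow_of_exponent_ge hδ hδ1 h
        _ = (δ ^ lam) ^ (2 * q) := by
            rw [Real.rpow_mul hδ.le, ← Real.rpow_natCast]; push_cast; rfl
        _ ≤ (δ ^ lam * m) ^ (2 * q) := by
            gcongr
            exact le_mul_of_one_le_right (by positivity) hm1
    · have hc := abs_coeff_mul_pow_le_of_forall_abs_le (by positivity) h2 hi hj
      calc |c i j| * δ ^ (i + j)
          = (|c i j| * (1 / (n : ℝ)) ^ (i + j)) * (δ * n) ^ (i + j) := by
            rw [mul_assoc, ← mul_pow]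
            congr 2
            field_simp
        _ ≤ (36 ^ q * (n * ((q : ℝ) ^ (2 * q) / n ^ q))) * ((δ * n) ^ lam) ^ (2 * q) := by
            gcongr
            calc (δ * n) ^ (i + j) = (δ * n) ^ ((i + j : ℕ) : ℝ) := (Real.rpow_natCast _ _).symm
              _ ≤ (δ * n) ^ (lam * (2 * q)) := Real.rpow_le_rpow_of_exponent_le hδn h
              _ = ((δ * n) ^ lam) ^ (2 * q) := by
                rw [Real.rpow_mul (by positivity), ← Real.rpow_natCast]; push_cast; rfl
        _ = 36 ^ q * n * (δ ^ lam * (q * (n : ℝ) ^ (lam - 1 / 2))) ^ (2 * q) := by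
            have e : ((n : ℝ) ^ (lam - 1 / 2)) ^ (2 * q) = ((n : ℝ) ^ lam) ^ (2 * q) / n ^ q := by
              rw [Real.rpow_sub hn0, div_pow, pow_mul ((n : ℝ) ^ (1 / 2 : ℝ)), ← Real.sqrt_eq_rpow,
                Real.sq_sqrt hn0.le]
            rw [Real.mul_rpow hδ.le hn0.le, mul_pow, mul_pow (δ ^ lam) _ (2 * q),
              mul_pow (q : ℝ) _ (2 * q), e]
            ring
        _ ≤ _ := by
            gcongr
            refine le_trans ?_ (le_max_right _ _)
            gcongr
            linarith [(Nat.cast_nonneg q : (0 : ℝ) ≤ q)]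
  calc ∑ i ∈ range (q + 1), (∑ j ∈ range (q + 1), c i j * t ^ j) * s ^ i
      ≤ ∑ i ∈ range (q + 1), ∑ j ∈ range (q + 1),
          36 ^ q * n * (δ ^ lam * m) ^ (2 * q) := by
        refine sum_le_sum fun i hi => ?_
        rw [sum_mul]
        refine sum_le_sum fun j hj => ?_
        refine le_trans ?_ (coeff i (by simpa [Nat.lt_succ_iff] using hi)
          j (by simpa [Nat.lt_succ_iff] using hj))
        rw [mul_assoc, pow_add, mul_comm (δ ^ i)]
        have hs' := pow_le_pow_left₀ hs.1 hs.2 i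
        have ht' := pow_le_pow_left₀ ht.1 ht.2 j
        have := pow_nonneg hs.1 i
        have := pow_nonneg ht.1 j
        gcongr
        exact le_abs_self _
    _ = _ := by
        simp only [sum_const, card_range, nsmul_eq_mul]
        push_cast
        ring

theorem counting_factors_le {n q : ℕ} (hq : q ≠ 0) (h1 : 13 * Real.log n ≤ q)
    (h2 : (q : ℝ) ≤ n / 2) :
    ((n : ℝ) + 1) ^ 2 * (((q : ℝ) + 1) ^ 2 * (36 ^ q * n)) ≤ 4 * 64 ^ q := by
  have hq1 : (1 : ℝ) ≤ q := by exact_mod_cast Nat.one_le_iff_ne_zero.mpr hq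
  have hn : (2 : ℝ) ≤ n := by linarith
  have h5 : (n : ℝ) ^ 5 ≤ (16 / 9) ^ q := by
    rw [← Real.log_le_log_iff (by positivity) (by positivity), Real.log_pow, Real.log_pow]
    have h := Real.one_sub_inv_le_log_of_pos (show (0 : ℝ) < 16 / 9 by norm_num)
    push_cast
    norm_num at h ⊢
    nlinarith
  calc ((n : ℝ) + 1) ^ 2 * (((q : ℝ) + 1) ^ 2 * (36 ^ q * n))
      ≤ (2 * n) ^ 2 * ((n : ℝ) ^ 2 * (36 ^ q * n)) := by gcongr <;> linarith
    _ = 4 * (n : ℝ) ^ 5 * 36 ^ q := by ring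
    _ ≤ 4 * (16 / 9) ^ q * 36 ^ q := by gcongr
    _ = 4 * 64 ^ q := by rw [mul_assoc, ← mul_pow]; norm_num

end Extrapolation

section Compression
variable {ι : Type*} [DecidableEq ι]

/-- The coordinate projection onto the indices in `S`. -/
def coordProj (S : Finset ι) : Matrix ι ι ℂ := Matrix.diagonal fun i => if i ∈ S then 1 else 0

theorem conjTranspose_coordProj (S : Finset ι) : (coordProj S)ᴴ = coordProj S := by
  rw [coordProj, Matrix.diagonal_conjTranspose]
  congr 1
  funext i
  simp only [Pi.star_apply]
  split_ifs <;> simp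

variable [Fintype ι]

theorem coordProj_mul_self (S : Finset ι) : coordProj S * coordProj S = coordProj S := by
  simp [coordProj]

theorem norm_coordProj_le (S : Finset ι) : ‖coordProj S‖ ≤ 1 := by
  rw [coordProj, Matrix.l2_opNorm_diagonal, pi_norm_le_iff_of_nonneg zero_le_one]
  intro i
  split_ifs <;> simp

theorem coordProj_mul_mul_apply (A : Matrix ι ι ℂ) (S T : Finset ι) (i j : ι) :
    (coordProj S * A * coordProj T) i j = if i ∈ S ∧ j ∈ T then A i j else 0 := by
  rw [coordProj, coordProj, Matrix.mul_diagonal, Matrix.diagonal_mul]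
  by_cases h1 : i ∈ S <;> by_cases h2 : j ∈ T <;> simp [h1, h2]

theorem norm_coordProj_mul_mul_le {A : Matrix ι ι ℂ} (hA : ‖A‖ ≤ 1) (S T : Finset ι) :
    ‖coordProj S * A * coordProj T‖ ≤ 1 := by
  calc _ ≤ ‖coordProj S‖ * ‖A‖ * ‖coordProj T‖ :=
        (norm_mul_le _ _).trans (mul_le_mul_of_nonneg_right (norm_mul_le _ _) (norm_nonneg _))
    _ ≤ 1 * 1 * 1 := by
        gcongr
        · exact norm_coordProj_le S
        · exact norm_coordProj_le T
    _ = 1 := by norm_num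

theorem sq_norm_coordProj_mul_mul_le {A : Matrix ι ι ℂ} {κ : ℝ} (hA : ∀ i j, ‖A i j‖ ^ 2 ≤ κ)
    (S T : Finset ι) : ‖coordProj S * A * coordProj T‖ ^ 2 ≤ #S * #T * κ := by
  refine (Matrix.l2_opNorm_sq_le_sum_norm_sq _).trans ?_
  calc ∑ i, ∑ j, ‖(coordProj S * A * coordProj T) i j‖ ^ 2
      ≤ ∑ i, ∑ j, if i ∈ S then (if j ∈ T then κ else 0) else 0 := by
        refine sum_le_sum fun i _ => sum_le_sum fun j _ => ?_
        rw [coordProj_mul_mul_apply]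
        by_cases h1 : i ∈ S <;> by_cases h2 : j ∈ T <;> simp [h1, h2, hA i j]
    _ = #S * #T * κ := by
        simp [mul_assoc]

/-- The trace of the `q`-th power of `B * Bᴴ`, where `B` is the compression of `A` to rows in `W`
and columns in `T`. -/
noncomputable def compressionMoment (A : Matrix ι ι ℂ) (q : ℕ) (p : Finset ι × Finset ι) : ℂ :=
  ((coordProj p.2 * (A * coordProj p.1 * Aᴴ)) ^ q).trace

theorem compressionMoment_eq (A : Matrix ι ι ℂ) {q : ℕ} (hq : q ≠ 0) (T W : Finset ι) :
    compressionMoment A q (T, W) = (((coordProj W * A * coordProj T) *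
      (coordProj W * A * coordProj T)ᴴ) ^ q).trace := by
  rw [compressionMoment, ← Matrix.trace_idempotent_mul_mul_pow (coordProj_mul_self _) _ hq]
  congr 2
  rw [Matrix.conjTranspose_mul, Matrix.conjTranspose_mul, conjTranspose_coordProj,
    conjTranspose_coordProj]
  simp only [← Matrix.mul_assoc]
  rw [Matrix.mul_assoc _ (coordProj T) (coordProj T), coordProj_mul_self]

theorem norm_pow_le_re_compressionMoment (A : Matrix ι ι ℂ) {q : ℕ} (hq : q ≠ 0)
    (T W : Finset ι) :
    ‖coordProj W * A * coordProj T‖ ^ (2 * q) ≤ (compressionMoment A q (T, W)).re := by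
  rw [compressionMoment_eq A hq]
  exact Matrix.norm_pow_le_re_trace _ hq

theorem re_compressionMoment_nonneg (A : Matrix ι ι ℂ) {q : ℕ} (hq : q ≠ 0) (T W : Finset ι) :
    0 ≤ (compressionMoment A q (T, W)).re :=
  le_trans (by positivity) (norm_pow_le_re_compressionMoment A hq T W)

theorem re_compressionMoment_le (A : Matrix ι ι ℂ) {q : ℕ} (hq : q ≠ 0) (T W : Finset ι) :
    (compressionMoment A q (T, W)).re ≤
      Fintype.card ι * ‖coordProj W * A * coordProj T‖ ^ (2 * q) := by
  rw [compressionMoment_eq A hq]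
  exact Matrix.re_trace_pow_le _ hq

theorem compressionMoment_mem_indicatorDegree (A : Matrix ι ι ℂ) (q : ℕ) :
    compressionMoment A q ∈ indicatorDegree ι q q := by
  refine trace_pow_mem_indicatorDegree
    (N := fun p => coordProj p.2 * (A * coordProj p.1 * Aᴴ)) (fun i j => ?_) q
  have e : (fun p : Finset ι × Finset ι => (coordProj p.2 * (A * coordProj p.1 * Aᴴ)) i j) =
      ∑ l, (A i l * Aᴴ l j) • fun p : Finset ι × Finset ι =>
        if l ∈ p.1 ∧ i ∈ p.2 then (1 : ℂ) else 0 := by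
    funext p
    rw [coordProj, Matrix.diagonal_mul, Matrix.mul_apply, Finset.sum_apply, mul_sum]
    refine sum_congr rfl fun l _ => ?_
    rw [coordProj, Matrix.mul_diagonal, Pi.smul_apply, smul_eq_mul]
    by_cases h1 : i ∈ p.2 <;> by_cases h2 : l ∈ p.1 <;> simp [h1, h2]
  rw [e]
  exact Submodule.sum_mem _ fun l _ =>
    Submodule.smul_mem _ _ (indicator_mem_indicatorDegree l i)

/-- The extrapolated moment bound for a random compression with Bernoulli selectors. -/
theorem sum_bernoulliWeight_compressionMoment_le [Nonempty ι] {A : Matrix ι ι ℂ} (hA : ‖A‖ ≤ 1)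
    (hA' : ∀ i j, ‖A i j‖ ^ 2 ≤ 1 / Fintype.card ι) {q : ℕ} (hq : 2 ≤ q)
    {δ : ℝ} (hδ0 : 1 / (Fintype.card ι : ℝ) ≤ δ) (hδ1 : δ ≤ 1) {lam : ℝ}
    {s t : ℝ} (hs : s ∈ Set.Icc 0 δ) (ht : t ∈ Set.Icc 0 δ) :
    ∑ T, bernoulliWeight s T * ∑ W, bernoulliWeight t W * (compressionMoment A q (T, W)).re ≤
      ((q : ℝ) + 1) ^ 2 * (36 ^ q * Fintype.card ι *
        (δ ^ lam * max 1 (2 * q * (Fintype.card ι : ℝ) ^ (lam - 1 / 2))) ^ (2 * q)) := by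
  have hq0 : q ≠ 0 := by omega
  set n := Fintype.card ι with hn
  have hn0 : (0 : ℝ) < n := by exact_mod_cast Fintype.card_pos
  have hn1 : 1 / (n : ℝ) ≤ 1 := hδ0.trans hδ1
  have hpos : ∀ T W, 0 ≤ (compressionMoment A q (T, W)).re :=
    re_compressionMoment_nonneg A hq0
  have habs : ∀ s ∈ Set.Icc (0 : ℝ) 1, ∀ t ∈ Set.Icc (0 : ℝ) 1,
      |∑ T, bernoulliWeight s T * ∑ W, bernoulliWeight t W * (compressionMoment A q (T, W)).re| =
      ∑ T, bernoulliWeight s T * ∑ W, bernoulliWeight t W * (compressionMoment A q (T, W)).re :=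
    fun s hs t ht => abs_of_nonneg <| sum_nonneg fun T _ =>
      mul_nonneg (bernoulliWeight_nonneg hs.1 hs.2 T) <| sum_nonneg fun W _ =>
        mul_nonneg (bernoulliWeight_nonneg ht.1 ht.2 W) (hpos T W)
  have hmono : ∀ s ∈ Set.Icc (0 : ℝ) 1, ∀ t ∈ Set.Icc (0 : ℝ) 1, ∀ (K : ℝ) (g h : Finset ι → ℝ),
      (∀ T W, (compressionMoment A q (T, W)).re ≤ K * g T * h W) →
      |∑ T, bernoulliWeight s T * ∑ W, bernoulliWeight t W * (compressionMoment A q (T, W)).re| ≤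
      K * (∑ T, bernoulliWeight s T * g T) * ∑ W, bernoulliWeight t W * h W := by
    intro s hs t ht K g h hle
    rw [habs s hs t ht]
    calc _ ≤ ∑ T, bernoulliWeight s T * ∑ W, bernoulliWeight t W * (K * g T * h W) :=
          sum_le_sum fun T _ =>
            mul_le_mul_of_nonneg_left (sum_le_sum fun W _ =>
              mul_le_mul_of_nonneg_left (hle T W) (bernoulliWeight_nonneg ht.1 ht.2 W))
              (bernoulliWeight_nonneg hs.1 hs.2 T)
      _ = _ := by
          rw [mul_assoc, sum_mul_sum, mul_sum]
          refine sum_congr rfl fun T _ => ?_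
          rw [mul_sum, mul_sum]
          exact sum_congr rfl fun W _ => by ring
  obtain ⟨c, hc⟩ := exists_coeff_of_mem_indicatorDegree (compressionMoment_mem_indicatorDegree A q)
  rw [hc]
  refine polynomial_extrapolation (by rw [hn]; exact Fintype.card_ne_zero) ?_ ?_ hδ0 hδ1 hs ht
  · intro s hs t ht
    rw [← hc]
    refine (hmono s hs t ht n (fun _ => 1) (fun _ => 1) fun T W => ?_).trans ?_
    · rw [mul_one, mul_one]
      refine (re_compressionMoment_le A hq0 T W).trans ?_
      refine mul_le_of_le_one_right (by positivity) ?_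
      exact pow_le_one₀ (norm_nonneg _) (norm_coordProj_mul_mul_le hA W T)
    · simp [sum_bernoulliWeight]
  · intro s hs t ht
    rw [← hc]
    have hs' : s ∈ Set.Icc (0 : ℝ) 1 := ⟨hs.1, hs.2.trans hn1⟩
    have ht' : t ∈ Set.Icc (0 : ℝ) 1 := ⟨ht.1, ht.2.trans hn1⟩
    refine (hmono s hs' t ht' (n * (1 / n) ^ q) (fun T => (#T : ℝ) ^ q)
      (fun W => (#W : ℝ) ^ q) fun T W => ?_).trans ?_
    · refine (re_compressionMoment_le A hq0 T W).trans ?_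
      calc _ ≤ (n : ℝ) * (#W * #T * (1 / n)) ^ q := by
            rw [pow_mul, ← hn]
            gcongr
            exact sq_norm_coordProj_mul_mul_le hA' W T
        _ = _ := by rw [mul_pow, mul_pow]; ring
    · have hs2 := sum_bernoulliWeight_mul_card_pow_le (ι := ι) hs'.1 hs'.2
        ((le_div_iff₀ hn0).mp hs.2) hq
      have ht2 := sum_bernoulliWeight_mul_card_pow_le (ι := ι) ht'.1 ht'.2
        ((le_div_iff₀ hn0).mp ht.2) hq
      have ht3 : 0 ≤ ∑ T : Finset ι, bernoulliWeight t T * (#T : ℝ) ^ q := sum_nonneg fun T _ =>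
        mul_nonneg (bernoulliWeight_nonneg ht'.1 ht'.2 T) (by positivity)
      calc _ ≤ (n * (1 / n : ℝ) ^ q) * (q : ℝ) ^ q * (q : ℝ) ^ q :=
            mul_le_mul (mul_le_mul_of_nonneg_left hs2 (by positivity)) ht2 ht3 (by positivity)
        _ = _ := by rw [one_div, inv_pow, two_mul, pow_add]; ring

end Compression

section DFT

theorem dftMatrix_eq (n : ℕ) (j t : Fin n) :
    dftMatrix n j t = (1 / (Real.sqrt n : ℂ)) *
      (Complex.exp (2 * Real.pi * Complex.I / n) ^ ((j : ℕ) + 1)) ^ ((t : ℕ) + 1) := by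
  rw [dftMatrix, ← Complex.exp_nat_mul, ← Complex.exp_nat_mul]
  congr 2
  push_cast
  ring

theorem norm_dftMatrix_apply_sq {n : ℕ} (j t : Fin n) : ‖dftMatrix n j t‖ ^ 2 = 1 / n := by
  have hn : (0 : ℝ) ≤ n := by positivity
  have hω : ‖Complex.exp (2 * Real.pi * Complex.I / n)‖ = 1 := by
    rw [show (2 * Real.pi * Complex.I / n : ℂ) = ((2 * Real.pi / n : ℝ) : ℂ) * Complex.I by
      push_cast; ring]
    exact Complex.norm_exp_ofReal_mul_I _
  rw [dftMatrix_eq, norm_mul, norm_pow, norm_pow, hω, one_pow, one_pow, mul_one, norm_div,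
    norm_one, Complex.norm_real, Real.norm_of_nonneg (Real.sqrt_nonneg _), div_pow, one_pow,
    Real.sq_sqrt hn]

theorem dftMatrix_mul_conjTranspose (n : ℕ) : dftMatrix n * (dftMatrix n)ᴴ = 1 := by
  ext j k
  have hn0 : n ≠ 0 := by have := j.2; omega
  have hω := Complex.isPrimitiveRoot_exp n hn0
  rw [Matrix.mul_apply, Matrix.one_apply]
  split_ifs with h
  · subst h
    have : ∀ t, dftMatrix n j t * (dftMatrix n)ᴴ t j = 1 / n := fun t => by
      rw [Matrix.conjTranspose_apply, Complex.star_def, Complex.mul_conj, Complex.normSq_eq_norm_sq,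
        norm_dftMatrix_apply_sq]
      push_cast
      rfl
    rw [sum_congr rfl fun t _ => this t]
    simp [hn0]
  · set ω := Complex.exp (2 * Real.pi * Complex.I / n) with hωdef
    have hnorm : ‖ω‖ = 1 := Complex.norm_eq_one_of_pow_eq_one hω.pow_eq_one hn0
    have hω0 : ω ≠ 0 := Complex.exp_ne_zero _
    have hstar : star ω = ω⁻¹ := (Complex.inv_eq_conj hnorm).symm
    set ζ := ω ^ ((j : ℕ) + 1) * (ω⁻¹) ^ ((k : ℕ) + 1) with hζ
    have hζn : ζ ^ n = 1 := by
      rw [hζ, mul_pow, ← pow_mul, ← pow_mul, mul_comm _ n, mul_comm _ n, pow_mul, pow_mul, inv_pow,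
        hω.pow_eq_one]
      simp
    have hζ1 : ζ ≠ 1 := by
      intro h1
      rw [hζ, inv_pow, mul_inv_eq_one₀ (pow_ne_zero _ hω0), pow_succ, pow_succ] at h1
      exact h (Fin.ext (hω.pow_inj j.2 k.2 (mul_right_cancel₀ hω0 h1)))
    have hsum : ∑ t ∈ range n, ζ ^ t = 0 := by
      have := geom_sum_mul ζ n
      rw [hζn, sub_self] at this
      exact (mul_eq_zero.mp this).resolve_right (sub_ne_zero.mpr hζ1)
    have hterm : ∀ t : Fin n, dftMatrix n j t * (dftMatrix n)ᴴ t k =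
        (1 / (Real.sqrt n : ℂ)) * star (1 / (Real.sqrt n : ℂ)) * ζ * ζ ^ (t : ℕ) := fun t => by
      rw [Matrix.conjTranspose_apply, dftMatrix_eq, dftMatrix_eq, ← hωdef, star_mul', star_pow,
        star_pow, hstar, mul_assoc _ ζ, ← pow_succ', hζ, mul_pow]
      ring
    rw [sum_congr rfl fun t _ => hterm t, ← mul_sum, Fin.sum_univ_eq_sum_range (fun t => ζ ^ t),
      hsum, mul_zero]

theorem norm_dftMatrix_le (n : ℕ) : ‖dftMatrix n‖ ≤ 1 := by
  have h : ‖dftMatrix n‖ * ‖dftMatrix n‖ = ‖(1 : Matrix (Fin n) (Fin n) ℂ)‖ := by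
    rw [← dftMatrix_mul_conjTranspose]
    exact CStarRing.norm_self_mul_star.symm
  have h1 : ‖(1 : Matrix (Fin n) (Fin n) ℂ)‖ ≤ 1 := by
    rw [← Matrix.diagonal_one, Matrix.l2_opNorm_diagonal]
    rw [pi_norm_le_iff_of_nonneg zero_le_one]
    simp
  nlinarith [norm_nonneg (dftMatrix n)]

theorem specNorm_submatrix_le {ι : Type*} [Fintype ι] [DecidableEq ι] (A : Matrix ι ι ℂ)
    (W T : Finset ι) [DecidableEq T] :
    specNorm (A.submatrix (fun w : W => (w : ι)) (fun t : T => (t : ι))) ≤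
      ‖coordProj W * A * coordProj T‖ := by
  rw [specNorm]
  refine ContinuousLinearMap.opNorm_le_bound _ (norm_nonneg _) fun x => ?_
  let y : EuclideanSpace ℂ ι := WithLp.toLp 2 fun i => if h : i ∈ T then x ⟨i, h⟩ else 0
  have hy : ‖y‖ = ‖x‖ := by
    rw [EuclideanSpace.norm_eq, EuclideanSpace.norm_eq,
      ← sum_subset (subset_univ T) fun i _ hi => by simp [y, hi], ← sum_coe_sort T]
    congr 1
    refine sum_congr rfl fun i _ => ?_
    simp [y]
  have h := Matrix.l2_opNorm_mulVec (coordProj W * A * coordProj T) y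
  rw [hy] at h
  refine le_trans ?_ h
  rw [EuclideanSpace.norm_eq, EuclideanSpace.norm_eq]
  refine Real.sqrt_le_sqrt ?_
  refine le_trans (le_of_eq ?_) (sum_le_sum_of_subset_of_nonneg (subset_univ W)
    fun i _ _ => sq_nonneg _)
  rw [← sum_coe_sort W]
  refine sum_congr rfl fun w _ => ?_
  congr 2
  change _ = ((coordProj W * A * coordProj T) *ᵥ y.ofLp) w
  simp only [LinearMap.coe_toContinuousLinearMap', Matrix.toLpLin_apply, Matrix.mulVec,
    dotProduct, coordProj_mul_mul_apply]
  rw [← sum_subset (subset_univ T) fun i _ hi => by simp [hi], ← sum_coe_sort T]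
  refine sum_congr rfl fun t _ => ?_
  simp [y]

end DFT

section Tail

/-- Markov's inequality for the `p`-th moment with respect to `uniformPairProb`. -/
theorem uniformPairProb_mul_pow_le {n mT mΩ : ℕ} {G : Finset (Fin n) → Finset (Fin n) → ℝ}
    (hG : ∀ T Ω, 0 ≤ G T Ω) {X : Finset (Fin n) → Finset (Fin n) → ℝ} {x : ℝ} (hx : 0 ≤ x) {p : ℕ}
    (hXG : ∀ T Ω, 0 ≤ X T Ω → X T Ω ^ p ≤ G T Ω) :
    uniformPairProb n mT mΩ (fun T Ω => x ≤ X T Ω) * x ^ p ≤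
      (∑ T ∈ powersetCard mT univ, ∑ Ω ∈ powersetCard mΩ univ, G T Ω) /
        ((n.choose mT : ℝ) * n.choose mΩ) := by
  rw [uniformPairProb, card_powersetCard, card_powersetCard, card_univ, Fintype.card_fin,
    Nat.cast_mul, div_mul_eq_mul_div]
  refine div_le_div_of_nonneg_right ?_ (by positivity)
  rw [← sum_product', ← nsmul_eq_mul]
  refine le_trans (card_nsmul_le_sum _ _ _ fun r hr => ?_)
    (sum_le_sum_of_subset_of_nonneg (filter_subset _ _) fun r _ _ => hG r.1 r.2)
  have hr' := (mem_filter.mp hr).2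
  exact (pow_le_pow_left₀ hx hr' p).trans (hXG _ _ (hx.trans hr'))

theorem uniformPairProb_le_one (n mT mΩ : ℕ) (p : Finset (Fin n) → Finset (Fin n) → Prop) :
    uniformPairProb n mT mΩ p ≤ 1 := by
  rw [uniformPairProb]
  refine div_le_one_of_le₀ ?_ (Nat.cast_nonneg _)
  rw [← card_product]
  exact_mod_cast card_filter_le _ _

/-- Comparison of uniformly random pairs of sets with pairs of Bernoulli random sets. -/
theorem sum_powersetCard_div_le_sum_bernoulliWeight {n : ℕ} (hn : n ≠ 0) {mT mΩ : ℕ}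
    (hT : mT ≤ n) (hΩ : mΩ ≤ n) {G : Finset (Fin n) → Finset (Fin n) → ℝ}
    (hG : ∀ T Ω, 0 ≤ G T Ω) :
    (∑ T ∈ powersetCard mT univ, ∑ Ω ∈ powersetCard mΩ univ, G T Ω) /
        ((n.choose mT : ℝ) * n.choose mΩ) ≤
      ((n : ℝ) + 1) ^ 2 * ∑ T, bernoulliWeight ((mT : ℝ) / n) T *
        ∑ Ω, bernoulliWeight ((mΩ : ℝ) / n) Ω * G T Ω := by
  have hcT : (0 : ℝ) < n.choose mT := by exact_mod_cast Nat.choose_pos hT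
  have hcΩ : (0 : ℝ) < n.choose mΩ := by exact_mod_cast Nat.choose_pos hΩ
  have hw : ∀ {m : ℕ}, m ≤ n → ∀ S : Finset (Fin n), 0 ≤ bernoulliWeight ((m : ℝ) / n) S :=
    fun hm S => bernoulliWeight_nonneg (by positivity)
      (div_le_one_of_le₀ (by exact_mod_cast hm) (by positivity)) S
  have hcard : Fintype.card (Fin n) = n := Fintype.card_fin n
  have key : ∀ {m : ℕ}, m ≤ n → ∀ {g : Finset (Fin n) → ℝ}, (∀ S, 0 ≤ g S) →
      ∑ S ∈ powersetCard m univ, g S ≤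
        ((n : ℝ) + 1) * n.choose m * ∑ S, bernoulliWeight ((m : ℝ) / n) S * g S := by
    intro m hm g hg
    have := sum_powersetCard_le_sum_bernoulliWeight (ι := Fin n) (by rwa [hcard])
      (hm.trans_eq hcard.symm) hg
    rwa [hcard] at this
  rw [div_le_iff₀ (by positivity)]
  calc _ ≤ ∑ T ∈ powersetCard mT univ, ((n : ℝ) + 1) * n.choose mΩ *
          ∑ Ω, bernoulliWeight ((mΩ : ℝ) / n) Ω * G T Ω :=
        sum_le_sum fun T _ => key hΩ (hG T)
    _ = ((n : ℝ) + 1) * n.choose mΩ * ∑ T ∈ powersetCard mT univ,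
          ∑ Ω, bernoulliWeight ((mΩ : ℝ) / n) Ω * G T Ω := by rw [mul_sum]
    _ ≤ ((n : ℝ) + 1) * n.choose mΩ * (((n : ℝ) + 1) * n.choose mT *
          ∑ T, bernoulliWeight ((mT : ℝ) / n) T *
            ∑ Ω, bernoulliWeight ((mΩ : ℝ) / n) Ω * G T Ω) := by
        refine mul_le_mul_of_nonneg_left (key hT fun T => ?_) (by positivity)
        exact sum_nonneg fun Ω _ => mul_nonneg (hw hΩ Ω) (hG T Ω)
    _ = _ := by ring

end Tail

end

/-- For independent uniformly random subsets `T, Ω` of fixed cardinalities, `δ ∈ [1/n, 1]` with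
`δ ≥ max{|T|,|Ω|}/n`, an integer `q` with `13 log n ≤ q ≤ n/2`, `λ ∈ [0,1]`, and `u ≥ 1`,
`P(‖F_{ΩT}‖ ≥ 8 δ^λ max{1, 2q n^{λ−1/2}} u) ≤ 4 u^{−2q}`. -/
theorem stmt_18 (n : ℕ) (mT mΩ : ℕ) (δ : ℝ)
    (hδ0 : 1 / (n : ℝ) ≤ δ) (hδ1 : δ ≤ 1) (hδ : ((max mT mΩ : ℕ) : ℝ) / n ≤ δ)
    (q : ℕ) (hq1 : 13 * Real.log n ≤ q) (hq2 : (q : ℝ) ≤ n / 2)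
    (lam : ℝ) (hlam0 : 0 ≤ lam) (hlam1 : lam ≤ 1) (u : ℝ) (hu : 1 ≤ u) :
    uniformPairProb n mT mΩ
        (fun T Ω =>
          8 * δ ^ lam * max 1 (2 * q * (n : ℝ) ^ (lam - 1 / 2)) * u ≤
            specNorm (dftSub n Ω T)) ≤
      4 * u ^ (-(2 * q : ℝ)) := by
  rcases Nat.eq_zero_or_pos q with rfl | hq
  · refine (uniformPairProb_le_one _ _ _ _).trans ?_
    norm_num
  have hq1' : (1 : ℝ) ≤ q := by exact_mod_cast hq
  have hn2 : (2 : ℝ) ≤ n := by linarith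
  have hn0 : (0 : ℝ) < n := by linarith
  have hn : n ≠ 0 := by rintro rfl; norm_num at hn0
  have hq2' : 2 ≤ q := by
    have h1 : Real.log 2 ≤ Real.log n := Real.log_le_log two_pos hn2
    have h2 := Real.log_two_gt_d9
    have h3 : (1 : ℝ) < q := by linarith
    exact_mod_cast h3
  have hmT : (mT : ℝ) / n ≤ δ := le_trans (by gcongr; exact le_max_left _ _) hδ
  have hmΩ : (mΩ : ℝ) / n ≤ δ := le_trans (by gcongr; exact le_max_right _ _) hδ
  have hmT' : mT ≤ n := by exact_mod_cast (div_le_one hn0).mp (hmT.trans hδ1)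
  have hmΩ' : mΩ ≤ n := by exact_mod_cast (div_le_one hn0).mp (hmΩ.trans hδ1)
  have : Nonempty (Fin n) := ⟨⟨0, Nat.pos_of_ne_zero hn⟩⟩
  have hδpos : 0 < δ := lt_of_lt_of_le (one_div_pos.mpr hn0) hδ0
  have hu0 : 0 < u := by linarith
  set y : ℝ := δ ^ lam * max 1 (2 * q * (n : ℝ) ^ (lam - 1 / 2)) with hy
  have hy0 : 0 < y := mul_pos (Real.rpow_pos_of_pos hδpos _) (lt_max_of_lt_left one_pos)
  have hx : 8 * δ ^ lam * max 1 (2 * q * (n : ℝ) ^ (lam - 1 / 2)) * u = 8 * y * u := by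
    rw [hy]; ring
  rw [hx]
  let G : Finset (Fin n) → Finset (Fin n) → ℝ := fun T Ω =>
    (compressionMoment (dftMatrix n) q (T, Ω)).re
  have hG : ∀ T Ω, 0 ≤ G T Ω := re_compressionMoment_nonneg (dftMatrix n) hq.ne'
  have hmoment := sum_bernoulliWeight_compressionMoment_le (A := dftMatrix n) (norm_dftMatrix_le n)
    (fun i j => by rw [norm_dftMatrix_apply_sq, Fintype.card_fin]) hq2'
    (by rwa [Fintype.card_fin]) hδ1 (lam := lam) (s := (mT : ℝ) / n) (t := (mΩ : ℝ) / n)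
    ⟨by positivity, hmT⟩ ⟨by positivity, hmΩ⟩
  rw [Fintype.card_fin, ← hy] at hmoment
  have hbound : uniformPairProb n mT mΩ (fun T Ω => 8 * y * u ≤ specNorm (dftSub n Ω T)) *
      (8 * y * u) ^ (2 * q) ≤ 4 * (8 * y) ^ (2 * q) :=
    calc _ ≤ _ := uniformPairProb_mul_pow_le hG (by positivity) fun T Ω h0 =>
          (pow_le_pow_left₀ h0 (specNorm_submatrix_le (dftMatrix n) Ω T) _).trans
            (norm_pow_le_re_compressionMoment (dftMatrix n) hq.ne' T Ω)
      _ ≤ _ := sum_powersetCard_div_le_sum_bernoulliWeight hn hmT' hmΩ' hG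
      _ ≤ ((n : ℝ) + 1) ^ 2 * (((q : ℝ) + 1) ^ 2 * (36 ^ q * n * y ^ (2 * q))) := by
          gcongr
      _ = ((n : ℝ) + 1) ^ 2 * (((q : ℝ) + 1) ^ 2 * (36 ^ q * n)) * y ^ (2 * q) := by ring
      _ ≤ 4 * 64 ^ q * y ^ (2 * q) := by
          exact mul_le_mul_of_nonneg_right (counting_factors_le hq.ne' hq1 hq2) (by positivity)
      _ = 4 * (8 * y) ^ (2 * q) := by
          rw [mul_pow 8 y, pow_mul 8 2 q]; norm_num; ring
  rw [Real.rpow_neg hu0.le, show (2 * q : ℝ) = ((2 * q : ℕ) : ℝ) by push_cast; rfl,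
    Real.rpow_natCast, ← div_eq_mul_inv, le_div_iff₀ (by positivity)]
  rw [mul_pow (8 * y) u] at hbound
  refine le_of_mul_le_mul_right (le_trans (le_of_eq ?_) hbound) (pow_pos (by positivity) (2 * q))
  ring
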